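/- arXiv:2208.07420 — 2 statements merged into one kernel-verified Lean document; each statement's English description precedes it below -/
import Mathlib

section
/- Let ℓ₁, ℓ₂, ℓ₃ be three pairwise distinct lines in ℂ². Then the composition of the three projections — first the projection onto ℓ₃ along ℓ₂, then the projection onto ℓ₂ along ℓ₁, then the projection onto ℓ₁ along ℓ₃ — restricted to ℓ₁ equals multiplication by −1 on ℓ₁. Equivalently, if a vector ξ₁ ∈ ℓ₁ is written ξ₁ = ξ₂ + ξ₃ with ξ₂ ∈ ℓ₂ and ξ₃ ∈ ℓ₃, then this composition sends ξ₁ to −ξ₁. -/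
/-- `p : ℂ² → ℂ²` is the linear projection onto the subspace `ℓ` along the subspace `ℓ'`:
every vector `v` decomposes as `v = p v + (v - p v)` with `p v ∈ ℓ` and `v - p v ∈ ℓ'`. -/
def IsProjOntoAlong (ℓ ℓ' : Submodule ℂ (Fin 2 → ℂ))
    (p : (Fin 2 → ℂ) →ₗ[ℂ] (Fin 2 → ℂ)) : Prop :=
  ∀ v, p v ∈ ℓ ∧ v - p v ∈ ℓ'

/-- Two distinct lines intersect only in zero. -/
theorem disjoint_of_finrank_eq_one {K V : Type*} [Field K] [AddCommGroup V] [Module K V]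
    {ℓ ℓ' : Submodule K V} (hℓ : Module.finrank K ℓ = 1) (hℓ' : Module.finrank K ℓ' = 1)
    (hne : ℓ ≠ ℓ') : Disjoint ℓ ℓ' :=
  (isSimpleModule_iff_isAtom.mp (isSimpleModule_iff_finrank_eq_one.mpr hℓ)).disjoint_of_ne
    (isSimpleModule_iff_isAtom.mp (isSimpleModule_iff_finrank_eq_one.mpr hℓ')) hne

/-- The value of a projection is determined by any decomposition along the two subspaces. -/
theorem IsProjOntoAlong.apply_eq {ℓ ℓ' : Submodule ℂ (Fin 2 → ℂ)}
    {p : (Fin 2 → ℂ) →ₗ[ℂ] (Fin 2 → ℂ)} (hp : IsProjOntoAlong ℓ ℓ' p) (hd : Disjoint ℓ ℓ')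
    {v w : Fin 2 → ℂ} (hw : w ∈ ℓ) (hvw : v - w ∈ ℓ') : p v = w := by
  refine sub_eq_zero.mp (Submodule.disjoint_def.mp hd _ (ℓ.sub_mem (hp v).1 hw) ?_)
  simpa using ℓ'.sub_mem hvw (hp v).2

/-- Let `ℓ₁, ℓ₂, ℓ₃` be three pairwise distinct lines (1-dimensional subspaces) in `ℂ²`.
Then the composition of the projection onto `ℓ₃` along `ℓ₂`, followed by the projection
onto `ℓ₂` along `ℓ₁`, followed by the projection onto `ℓ₁` along `ℓ₃`, restricted to `ℓ₁`,
is multiplication by `-1`. -/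
theorem stmt0 (ℓ₁ ℓ₂ ℓ₃ : Submodule ℂ (Fin 2 → ℂ))
    (hr₁ : Module.finrank ℂ ℓ₁ = 1) (hr₂ : Module.finrank ℂ ℓ₂ = 1)
    (hr₃ : Module.finrank ℂ ℓ₃ = 1)
    (h₁₂ : ℓ₁ ≠ ℓ₂) (h₂₃ : ℓ₂ ≠ ℓ₃) (h₁₃ : ℓ₁ ≠ ℓ₃)
    (p₁ p₂ p₃ : (Fin 2 → ℂ) →ₗ[ℂ] (Fin 2 → ℂ))
    (hp₁ : IsProjOntoAlong ℓ₃ ℓ₂ p₁)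
    (hp₂ : IsProjOntoAlong ℓ₂ ℓ₁ p₂)
    (hp₃ : IsProjOntoAlong ℓ₁ ℓ₃ p₃) :
    ∀ ξ₁ ∈ ℓ₁, p₃ (p₂ (p₁ ξ₁)) = -ξ₁ := by
  intro ξ hξ
  obtain ⟨h₃, h₂⟩ := hp₁ ξ
  have hp₂_eq : p₂ (p₁ ξ) = -(ξ - p₁ ξ) :=
    hp₂.apply_eq (disjoint_of_finrank_eq_one hr₂ hr₁ h₁₂.symm) (ℓ₂.neg_mem h₂) (by simpa using hξ)
  rw [hp₂_eq]
  exact hp₃.apply_eq (disjoint_of_finrank_eq_one hr₁ hr₃ h₁₃) (ℓ₁.neg_mem hξ) (by simpa using h₃)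
end

section
/- Let ℓ₀, ℓ₁, ℓ₂, ℓ₃ be pairwise distinct lines in ℂ², let ξⱼ ∈ ℓⱼ be nonzero vectors and z ∈ ℂ a scalar satisfying ξ₁ = ξ₃ + ξ₀ and ξ₁ = ξ₂ + z·ξ₀. Then z ≠ 0, z ≠ 1, and the composition (projection onto ℓ₂ along ℓ₁) ∘ (projection onto ℓ₀ along ℓ₃) sends ξ₂ to (1 − 1/z)·ξ₂. -/
theorem disjoint_of_finrank_eq_one_s2 {ℓ ℓ' : Submodule ℂ (Fin 2 → ℂ)}
    (h : Module.finrank ℂ ℓ = 1) (h' : Module.finrank ℂ ℓ' = 1) (hne : ℓ ≠ ℓ') :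
    Disjoint ℓ ℓ' :=
  (Submodule.isAtom_iff_finrank_eq_one.2 h).disjoint_of_ne
    (Submodule.isAtom_iff_finrank_eq_one.2 h') hne

theorem IsProjOntoAlong.apply_add {ℓ ℓ' : Submodule ℂ (Fin 2 → ℂ)}
    {p : (Fin 2 → ℂ) →ₗ[ℂ] (Fin 2 → ℂ)} (hp : IsProjOntoAlong ℓ ℓ' p) (hd : Disjoint ℓ ℓ')
    {a b : Fin 2 → ℂ} (ha : a ∈ ℓ) (hb : b ∈ ℓ') : p (a + b) = a := by
  obtain ⟨h, h'⟩ := hp (a + b)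
  refine sub_eq_zero.1 (Submodule.disjoint_def.1 hd _ (ℓ.sub_mem h ha) ?_)
  convert ℓ'.sub_mem hb h' using 1
  abel

/-- Let `ℓ₀, ℓ₁, ℓ₂, ℓ₃` be pairwise distinct lines in `ℂ²`, let `ξⱼ ∈ ℓⱼ` be nonzero
vectors and `z ∈ ℂ` a scalar with `ξ₁ = ξ₃ + ξ₀` and `ξ₁ = ξ₂ + z • ξ₀`.  Then `z ≠ 0`,
`z ≠ 1`, and (projection onto `ℓ₂` along `ℓ₁`) ∘ (projection onto `ℓ₀` along `ℓ₃`)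
sends `ξ₂` to `(1 - 1/z) • ξ₂`. -/
theorem stmt2 (ℓ₀ ℓ₁ ℓ₂ ℓ₃ : Submodule ℂ (Fin 2 → ℂ))
    (hr₀ : Module.finrank ℂ ℓ₀ = 1) (hr₁ : Module.finrank ℂ ℓ₁ = 1)
    (hr₂ : Module.finrank ℂ ℓ₂ = 1) (hr₃ : Module.finrank ℂ ℓ₃ = 1)
    (h₀₁ : ℓ₀ ≠ ℓ₁) (h₀₂ : ℓ₀ ≠ ℓ₂) (h₀₃ : ℓ₀ ≠ ℓ₃)
    (h₁₂ : ℓ₁ ≠ ℓ₂) (h₁₃ : ℓ₁ ≠ ℓ₃) (h₂₃ : ℓ₂ ≠ ℓ₃)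
    (ξ₀ ξ₁ ξ₂ ξ₃ : Fin 2 → ℂ) (z : ℂ)
    (hξ₀ : ξ₀ ∈ ℓ₀) (hξ₁ : ξ₁ ∈ ℓ₁) (hξ₂ : ξ₂ ∈ ℓ₂) (hξ₃ : ξ₃ ∈ ℓ₃)
    (hn₀ : ξ₀ ≠ 0) (hn₁ : ξ₁ ≠ 0) (hn₂ : ξ₂ ≠ 0) (hn₃ : ξ₃ ≠ 0)
    (e₁ : ξ₁ = ξ₃ + ξ₀) (e₂ : ξ₁ = ξ₂ + z • ξ₀)
    (p q : (Fin 2 → ℂ) →ₗ[ℂ] (Fin 2 → ℂ))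
    (hp : IsProjOntoAlong ℓ₂ ℓ₁ p)
    (hq : IsProjOntoAlong ℓ₀ ℓ₃ q) :
    z ≠ 0 ∧ z ≠ 1 ∧ p (q ξ₂) = (1 - 1/z) • ξ₂ := by
  have hz₀ : z ≠ 0 := by
    rintro rfl
    rw [zero_smul, add_zero] at e₂
    exact hn₁ (Submodule.disjoint_def.1 (disjoint_of_finrank_eq_one_s2 hr₁ hr₂ h₁₂) _ hξ₁ (e₂ ▸ hξ₂))
  have hz₁ : z ≠ 1 := by
    rintro rfl
    rw [one_smul, e₁, add_left_inj] at e₂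
    exact hn₂ (Submodule.disjoint_def.1 (disjoint_of_finrank_eq_one_s2 hr₂ hr₃ h₂₃) _ hξ₂ (e₂ ▸ hξ₃))
  refine ⟨hz₀, hz₁, ?_⟩
  have hq₂ : q ξ₂ = (1 - z) • ξ₀ := by
    have h : ξ₂ = (1 - z) • ξ₀ + ξ₃ := by
      rw [eq_sub_of_add_eq e₂.symm, e₁]
      module
    rw [h]
    exact hq.apply_add (disjoint_of_finrank_eq_one_s2 hr₀ hr₃ h₀₃) (ℓ₀.smul_mem _ hξ₀) hξ₃
  have hp₀ : p ξ₀ = (-z⁻¹) • ξ₂ := by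
    have h : ξ₀ = (-z⁻¹) • ξ₂ + z⁻¹ • ξ₁ := by
      rw [e₂, smul_add, smul_smul, inv_mul_cancel₀ hz₀]
      module
    conv_lhs => rw [h]
    exact hp.apply_add (disjoint_of_finrank_eq_one_s2 hr₂ hr₁ h₁₂.symm) (ℓ₂.smul_mem _ hξ₂)
      (ℓ₁.smul_mem _ hξ₁)
  rw [hq₂, map_smul, hp₀, smul_smul]
  congr 1
  field_simp
  ring
end
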